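/- For every 1 ≤ i ≤ n one has in 𝒟_n ⊗ 𝒟_n: (ι⊗ι)(Δ(E_i)) = 𝐢 Σ_{k=1}^{4i} q^{k−1} Z_1 Z_2 ⋯ Z_k and (ι⊗ι)(Δ(K_i)) = q^{4i} Z_1 Z_2 ⋯ Z_{4i+1}, where (Z_1, …, Z_{4i+1}) = (X_{V_{i,−i}}⊗1, X_{V_{i,1−i}}⊗1, …, X_{V_{i,i−1}}⊗1, X_{V_{i,i}}⊗X_{V_{i,−i}}, 1⊗X_{V_{i,1−i}}, …, 1⊗X_{V_{i,i}}) is the VV_i-path; likewise (ι⊗ι)(Δ(F_{θ(i)})) = 𝐢 Σ_{k=1}^{4i} q^{k−1} W_1 W_2 ⋯ W_k and (ι⊗ι)(Δ(K'_{θ(i)})) = q^{4i} W_1 W_2 ⋯ W_{4i+1}, where (W_1, …, W_{4i+1}) = (1⊗X_{Λ_{i,−i}}, …, 1⊗X_{Λ_{i,i−1}}, X_{Λ_{i,−i}}⊗X_{Λ_{i,i}}, X_{Λ_{i,1−i}}⊗1, …, X_{Λ_{i,i}}⊗1). Consequently (ι⊗ι)∘Δ maps 𝔇_n into the subalgebra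 𝒵_n ⊆ 𝒟_n ⊗ 𝒟_n. -/

import Mathlib

noncomputable section

/-- The ground field `𝕂 = ℂ(q)`, the field of rational functions over `ℂ`. -/
abbrev Kq : Type := RatFunc ℂ

/-- The formal variable `q ∈ ℂ(q)`. -/
def qq : Kq := RatFunc.X

/-- `𝐢 = √−1 ∈ ℂ`, viewed as a constant in `𝕂 = ℂ(q)`. -/
def ii : Kq := RatFunc.C Complex.I

/-- `θ(i) = n + 1 − i`. -/
def th (n : ℕ) (i : ℤ) : ℤ := (n : ℤ) + 1 - i

/-- Labels for the vertices of the `𝒟ₙ`-quiver: `V i r` stands for `V_{i,r}`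
(the canonical labels), and `C i` stands for the central vertex `Λ_{i,0}`. -/
inductive DnLabel : Type
  | V : ℤ → ℤ → DnLabel
  | C : ℤ → DnLabel
deriving DecidableEq

/-- Validity of a label for given rank `n`: `V i r` requires `1 ≤ i ≤ n`, `−i ≤ r ≤ i`;
`C i` requires `1 ≤ i ≤ n`.  There are `n² + 3n` valid labels. -/
def DnLabel.valid (n : ℕ) : DnLabel → Prop
  | .V i r => 1 ≤ i ∧ i ≤ (n : ℤ) ∧ -i ≤ r ∧ r ≤ i
  | .C i => 1 ≤ i ∧ i ≤ (n : ℤ)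

instance (n : ℕ) (v : DnLabel) : Decidable (v.valid n) := by
  cases v <;> unfold DnLabel.valid <;> infer_instance

/-- The vertex set of the `𝒟ₙ`-quiver. -/
def DnVertex (n : ℕ) := {v : DnLabel // v.valid n}

/-- The canonical label of the vertex `Λ_{i,r}`, using the identifications
`Λ_{a,b} = V_{θ(b),−θ(a)}` for `b > 0` and `Λ_{a,b} = V_{θ(−b),θ(a)}` for `b < 0`. -/
def Lam (n : ℕ) (i r : ℤ) : DnLabel :=
  if 0 < r then .V (th n r) (-(th n i))
  else if r < 0 then .V (th n (-r)) (th n i)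
  else .C i

/-- The list of arrows `(source, target, doubled weight)` of the `𝒟ₙ`-quiver, obtained by
amalgamating two copies of the Fock–Goncharov `(n+1)`-triangle quiver along two pairs of
sides.  Solid (weight `1`) arrows get doubled weight `2`, dashed (weight `1/2`) arrows get
doubled weight `1`.  The families are: the horizontal `V_i`- and `Λ_i`-path arrows, the
dashed boundary arrows along the two frozen columns, and, for each `1 ≤ i < n`, the
oriented cycle `V_{i,0} → V_{i+1,−1} → ⋯ → V_{n,i−n} → Λ_{i,0} → V_{n,n−i} → ⋯ → V_{i+1,1} → V_{i,0}`
through the central column. -/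
def dnArrows (n : ℕ) : List (DnLabel × DnLabel × ℤ) :=
  ((List.range n).flatMap fun i0 =>
    (List.range (2 * i0 + 2)).map fun k =>
      (DnLabel.V ((i0 : ℤ) + 1) (-((i0 : ℤ) + 1) + k),
       DnLabel.V ((i0 : ℤ) + 1) (-((i0 : ℤ) + 1) + k + 1), 2))
  ++ ((List.range n).flatMap fun i0 =>
    (List.range (2 * i0 + 2)).map fun k =>
      (Lam n ((i0 : ℤ) + 1) (-((i0 : ℤ) + 1) + k),
       Lam n ((i0 : ℤ) + 1) (-((i0 : ℤ) + 1) + k + 1), 2))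
  ++ ((List.range (n - 1)).map fun i0 =>
      (DnLabel.V ((i0 : ℤ) + 1) (-((i0 : ℤ) + 1)),
       DnLabel.V ((i0 : ℤ) + 2) (-((i0 : ℤ) + 2)), 1))
  ++ ((List.range (n - 1)).map fun i0 =>
      (DnLabel.V ((i0 : ℤ) + 2) ((i0 : ℤ) + 2),
       DnLabel.V ((i0 : ℤ) + 1) ((i0 : ℤ) + 1), 1))
  ++ ((List.range (n - 1)).flatMap fun i0 =>
      (((List.range (n - 1 - i0)).map fun k =>
          (DnLabel.V ((i0 : ℤ) + 1 + k) (-(k : ℤ)),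
           DnLabel.V ((i0 : ℤ) + 2 + k) (-(k : ℤ) - 1), 2))
        ++ [(DnLabel.V (n : ℤ) ((i0 : ℤ) + 1 - n), DnLabel.C ((i0 : ℤ) + 1), 2),
            (DnLabel.C ((i0 : ℤ) + 1), DnLabel.V (n : ℤ) ((n : ℤ) - (i0 + 1)), 2)]
        ++ ((List.range (n - 1 - i0)).map fun k =>
          (DnLabel.V ((i0 : ℤ) + 2 + k) ((k : ℤ) + 1),
           DnLabel.V ((i0 : ℤ) + 1 + k) (k : ℤ), 2))))

/-- The doubled exchange matrix `2·ε_{uv}` of the `𝒟ₙ`-quiver. -/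
def eps2 (n : ℕ) (u v : DnLabel) : ℤ :=
  ((dnArrows n).map fun a =>
    (if a.1 = u ∧ a.2.1 = v then a.2.2 else 0)
      - (if a.1 = v ∧ a.2.1 = u then a.2.2 else 0)).sum

/-- The defining relations of the quantum torus algebra `𝒟ₙ`: generators `X_v^{±1}`
(`Sum.inl v` is `X_v`, `Sum.inr v` is `X_v⁻¹`) with `X_u X_v = q^{2 ε_{vu}} X_v X_u`. -/
inductive DnRel (n : ℕ) :
    FreeAlgebra Kq (DnVertex n ⊕ DnVertex n) →
      FreeAlgebra Kq (DnVertex n ⊕ DnVertex n) → Prop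
  | comm (u v : DnVertex n) :
      DnRel n (FreeAlgebra.ι Kq (Sum.inl u) * FreeAlgebra.ι Kq (Sum.inl v))
        ((qq ^ eps2 n v.1 u.1) • (FreeAlgebra.ι Kq (Sum.inl v) * FreeAlgebra.ι Kq (Sum.inl u)))
  | mul_inv (v : DnVertex n) :
      DnRel n (FreeAlgebra.ι Kq (Sum.inl v) * FreeAlgebra.ι Kq (Sum.inr v)) 1
  | inv_mul (v : DnVertex n) :
      DnRel n (FreeAlgebra.ι Kq (Sum.inr v) * FreeAlgebra.ι Kq (Sum.inl v)) 1

/-- The quantum torus algebra `𝒟ₙ`. -/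
abbrev Dtorus (n : ℕ) := RingQuot (DnRel n)

/-- The cluster variable `X_v ∈ 𝒟ₙ` attached to a label (junk value `1` on invalid labels). -/
def Xg (n : ℕ) (v : DnLabel) : Dtorus n :=
  if h : v.valid n then RingQuot.mkAlgHom Kq (DnRel n) (FreeAlgebra.ι Kq (Sum.inl ⟨v, h⟩)) else 1

/-- The inverse cluster variable `X_v⁻¹ ∈ 𝒟ₙ` (junk value `1` on invalid labels). -/
def Xinv (n : ℕ) (v : DnLabel) : Dtorus n :=
  if h : v.valid n then RingQuot.mkAlgHom Kq (DnRel n) (FreeAlgebra.ι Kq (Sum.inr ⟨v, h⟩)) else 1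

/-- The ordered product `X_{V_{i,−i}} X_{V_{i,1−i}} ⋯ X_{V_{i,r}}`. -/
def Vprod (n : ℕ) (i r : ℤ) : Dtorus n :=
  ((List.range (r + i + 1).toNat).map fun k => Xg n (.V i (-i + k))).prod

/-- The ordered product `X_{Λ_{i,−i}} X_{Λ_{i,1−i}} ⋯ X_{Λ_{i,r}}`. -/
def Lprod (n : ℕ) (i r : ℤ) : Dtorus n :=
  ((List.range (r + i + 1).toNat).map fun k => Xg n (Lam n i (-i + k))).prod

/-- `w_i^r = 𝐢 q^{i+r} X_{V_{i,−i}} X_{V_{i,1−i}} ⋯ X_{V_{i,r}}`. -/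
def ww (n : ℕ) (i r : ℤ) : Dtorus n := (ii * qq ^ (i + r)) • Vprod n i r

/-- `m_i^r = 𝐢 q^{i+r} X_{Λ_{i,−i}} X_{Λ_{i,1−i}} ⋯ X_{Λ_{i,r}}`. -/
def mm (n : ℕ) (i r : ℤ) : Dtorus n := (ii * qq ^ (i + r)) • Lprod n i r


/-- Index set `{1, …, n} ⊂ ℤ`. -/
def Idx (n : ℕ) := {i : ℤ // 1 ≤ i ∧ i ≤ (n : ℤ)}

/-- `θ` as a map on the index set. -/
def thIdx (n : ℕ) (i : Idx n) : Idx n :=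
  ⟨th n i.1, by obtain ⟨h1, h2⟩ := i.2; unfold th; constructor <;> omega⟩

/-- Generators of the Drinfeld double `𝔇ₙ`. -/
inductive DDGen (n : ℕ) : Type
  | E : Idx n → DDGen n
  | F : Idx n → DDGen n
  | K : Idx n → DDGen n
  | K' : Idx n → DDGen n
  | Kinv : Idx n → DDGen n
  | K'inv : Idx n → DDGen n

/-- The Cartan matrix of type `Aₙ`. -/
def cartanA (i j : ℤ) : ℤ := if i = j then 2 else if (i - j).natAbs = 1 then -1 else 0

/-- Shorthand for the generators inside the free algebra. -/
def ddg (n : ℕ) (g : DDGen n) : FreeAlgebra Kq (DDGen n) := FreeAlgebra.ι Kq g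

/-- The defining relations of the Drinfeld double `𝔇ₙ`. -/
inductive DDRel (n : ℕ) : FreeAlgebra Kq (DDGen n) → FreeAlgebra Kq (DDGen n) → Prop
  | KE (i j : Idx n) : DDRel n (ddg n (.K i) * ddg n (.E j))
      ((qq ^ cartanA i.1 j.1) • (ddg n (.E j) * ddg n (.K i)))
  | K'E (i j : Idx n) : DDRel n (ddg n (.K' i) * ddg n (.E j))
      ((qq ^ (-cartanA i.1 j.1)) • (ddg n (.E j) * ddg n (.K' i)))
  | KF (i j : Idx n) : DDRel n (ddg n (.K i) * ddg n (.F j))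
      ((qq ^ (-cartanA i.1 j.1)) • (ddg n (.F j) * ddg n (.K i)))
  | K'F (i j : Idx n) : DDRel n (ddg n (.K' i) * ddg n (.F j))
      ((qq ^ cartanA i.1 j.1) • (ddg n (.F j) * ddg n (.K' i)))
  | KK (i j : Idx n) : DDRel n (ddg n (.K i) * ddg n (.K j)) (ddg n (.K j) * ddg n (.K i))
  | KK' (i j : Idx n) : DDRel n (ddg n (.K i) * ddg n (.K' j)) (ddg n (.K' j) * ddg n (.K i))
  | K'K' (i j : Idx n) : DDRel n (ddg n (.K' i) * ddg n (.K' j)) (ddg n (.K' j) * ddg n (.K' i))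
  | K_Kinv (i : Idx n) : DDRel n (ddg n (.K i) * ddg n (.Kinv i)) 1
  | Kinv_K (i : Idx n) : DDRel n (ddg n (.Kinv i) * ddg n (.K i)) 1
  | K'_K'inv (i : Idx n) : DDRel n (ddg n (.K' i) * ddg n (.K'inv i)) 1
  | K'inv_K' (i : Idx n) : DDRel n (ddg n (.K'inv i) * ddg n (.K' i)) 1
  | EF (i j : Idx n) : DDRel n (ddg n (.E i) * ddg n (.F j))
      (ddg n (.F j) * ddg n (.E i)
        + (if i.1 = j.1 then qq - qq⁻¹ else 0) • (ddg n (.K i) - ddg n (.K' i)))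
  | serreE (i j : Idx n) (h : (i.1 - j.1).natAbs = 1) :
      DDRel n (ddg n (.E i) * ddg n (.E i) * ddg n (.E j)
          + ddg n (.E j) * (ddg n (.E i) * ddg n (.E i)))
        ((qq + qq⁻¹) • (ddg n (.E i) * ddg n (.E j) * ddg n (.E i)))
  | serreF (i j : Idx n) (h : (i.1 - j.1).natAbs = 1) :
      DDRel n (ddg n (.F i) * ddg n (.F i) * ddg n (.F j)
          + ddg n (.F j) * (ddg n (.F i) * ddg n (.F i)))
        ((qq + qq⁻¹) • (ddg n (.F i) * ddg n (.F j) * ddg n (.F i)))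
  | EEc (i j : Idx n) (h : 1 < (i.1 - j.1).natAbs) :
      DDRel n (ddg n (.E i) * ddg n (.E j)) (ddg n (.E j) * ddg n (.E i))
  | FFc (i j : Idx n) (h : 1 < (i.1 - j.1).natAbs) :
      DDRel n (ddg n (.F i) * ddg n (.F j)) (ddg n (.F j) * ddg n (.F i))

/-- The Drinfeld double `𝔇ₙ` of the quantum Borel subalgebra of `U_q(sl_{n+1})`. -/
abbrev DDalg (n : ℕ) := RingQuot (DDRel n)

/-- The generators of `𝔇ₙ`. -/
def DDgen (n : ℕ) (g : DDGen n) : DDalg n := RingQuot.mkAlgHom Kq (DDRel n) (ddg n g)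

/-- The defining property of the embedding `ι : 𝔇ₙ → 𝒟ₙ`:
`ι(E_i) = Σ_{r=−i}^{i−1} w_i^r`, `ι(K_i) = q^{2i} X_{V_{i,−i}} ⋯ X_{V_{i,i}}`,
`ι(F_{θ(i)}) = Σ_{r=−i}^{i−1} m_i^r`, `ι(K'_{θ(i)}) = q^{2i} X_{Λ_{i,−i}} ⋯ X_{Λ_{i,i}}`,
and `K_i^{−1}`, `(K_i')^{−1}` are sent to the inverses of the images of `K_i`, `K_i'`. -/
def iotaSpec (n : ℕ) (f : DDalg n →ₐ[Kq] Dtorus n) : Prop :=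
  ∀ i : Idx n,
    f (DDgen n (.E i)) = ∑ r ∈ Finset.Icc (-i.1) (i.1 - 1), ww n i.1 r ∧
    f (DDgen n (.K i)) = (qq ^ (2 * i.1)) • Vprod n i.1 i.1 ∧
    f (DDgen n (.F (thIdx n i))) = ∑ r ∈ Finset.Icc (-i.1) (i.1 - 1), mm n i.1 r ∧
    f (DDgen n (.K' (thIdx n i))) = (qq ^ (2 * i.1)) • Lprod n i.1 i.1 ∧
    f (DDgen n (.Kinv i)) * f (DDgen n (.K i)) = 1 ∧
    f (DDgen n (.K i)) * f (DDgen n (.Kinv i)) = 1 ∧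
    f (DDgen n (.K'inv i)) * f (DDgen n (.K' i)) = 1 ∧
    f (DDgen n (.K' i)) * f (DDgen n (.K'inv i)) = 1

open scoped TensorProduct

/-- `A = 𝒟ₙ ⊗_𝕂 𝒟ₙ`. -/
abbrev AA (n : ℕ) := Dtorus n ⊗[Kq] Dtorus n

/-- The defining property of the coproduct `Δ` of `𝔇ₙ`:
`Δ(E_i) = E_i ⊗ 1 + K_i ⊗ E_i`, `Δ(F_i) = F_i ⊗ K_i' + 1 ⊗ F_i`,
`Δ(K_i) = K_i ⊗ K_i`, `Δ(K_i') = K_i' ⊗ K_i'`. -/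
def deltaSpec (n : ℕ) (Δ : DDalg n →ₐ[Kq] (DDalg n ⊗[Kq] DDalg n)) : Prop :=
  ∀ i : Idx n,
    Δ (DDgen n (.E i)) = DDgen n (.E i) ⊗ₜ[Kq] 1 + DDgen n (.K i) ⊗ₜ[Kq] DDgen n (.E i) ∧
    Δ (DDgen n (.F i)) = DDgen n (.F i) ⊗ₜ[Kq] DDgen n (.K' i) + 1 ⊗ₜ[Kq] DDgen n (.F i) ∧
    Δ (DDgen n (.K i)) = DDgen n (.K i) ⊗ₜ[Kq] DDgen n (.K i) ∧
    Δ (DDgen n (.K' i)) = DDgen n (.K' i) ⊗ₜ[Kq] DDgen n (.K' i) ∧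
    Δ (DDgen n (.Kinv i)) = DDgen n (.Kinv i) ⊗ₜ[Kq] DDgen n (.Kinv i) ∧
    Δ (DDgen n (.K'inv i)) = DDgen n (.K'inv i) ⊗ₜ[Kq] DDgen n (.K'inv i)

/-- The generating set of the subalgebra `𝒵ₙ ⊆ 𝒟ₙ ⊗ 𝒟ₙ`: the elements `X_v ⊗ 1` for
vertices `v ∉ {V_{j,j}}`, the elements `1 ⊗ X_v` for `v ∉ {V_{j,−j}}`, the elements
`X_{V_{j,j}} ⊗ X_{V_{j,−j}}` for `1 ≤ j ≤ n`, and their inverses. -/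
def Zset (n : ℕ) : Set (AA n) :=
  {x | ∃ v : DnLabel, v.valid n ∧ (∀ j : ℤ, v ≠ .V j j) ∧
        (x = (Xg n v) ⊗ₜ[Kq] 1 ∨ x = (Xinv n v) ⊗ₜ[Kq] 1)} ∪
  {x | ∃ v : DnLabel, v.valid n ∧ (∀ j : ℤ, v ≠ .V j (-j)) ∧
        (x = 1 ⊗ₜ[Kq] (Xg n v) ∨ x = 1 ⊗ₜ[Kq] (Xinv n v))} ∪
  {x | ∃ j : ℤ, 1 ≤ j ∧ j ≤ (n : ℤ) ∧
        (x = (Xg n (.V j j)) ⊗ₜ[Kq] (Xg n (.V j (-j))) ∨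
         x = (Xinv n (.V j j)) ⊗ₜ[Kq] (Xinv n (.V j (-j))))}

/-- The subalgebra `𝒵ₙ ⊆ 𝒟ₙ ⊗ 𝒟ₙ`, the quantum torus of the quiver obtained by
amalgamating two `𝒟ₙ`-quivers along the column of frozen vertices. -/
def Zalg (n : ℕ) : Subalgebra Kq (AA n) := Algebra.adjoin Kq (Zset n)

/-- The `VV_i`-path `(Z_1, …, Z_{4i+1})`:
`(X_{V_{i,−i}}⊗1, …, X_{V_{i,i−1}}⊗1, X_{V_{i,i}}⊗X_{V_{i,−i}}, 1⊗X_{V_{i,1−i}}, …, 1⊗X_{V_{i,i}})`. -/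
def Zpath (n : ℕ) (i : ℤ) (k : ℕ) : AA n :=
  if (k : ℤ) ≤ 2 * i then (Xg n (.V i (-i + k - 1))) ⊗ₜ[Kq] 1
  else if (k : ℤ) = 2 * i + 1 then (Xg n (.V i i)) ⊗ₜ[Kq] (Xg n (.V i (-i)))
  else 1 ⊗ₜ[Kq] (Xg n (.V i (-i + k - 2 * i - 1)))

/-- The `ΛΛ_i`-path `(W_1, …, W_{4i+1})`:
`(1⊗X_{Λ_{i,−i}}, …, 1⊗X_{Λ_{i,i−1}}, X_{Λ_{i,−i}}⊗X_{Λ_{i,i}}, X_{Λ_{i,1−i}}⊗1, …, X_{Λ_{i,i}}⊗1)`. -/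
def Wpath (n : ℕ) (i : ℤ) (k : ℕ) : AA n :=
  if (k : ℤ) ≤ 2 * i then 1 ⊗ₜ[Kq] (Xg n (Lam n i (-i + k - 1)))
  else if (k : ℤ) = 2 * i + 1 then (Xg n (Lam n i (-i))) ⊗ₜ[Kq] (Xg n (Lam n i i))
  else (Xg n (Lam n i (-i + k - 2 * i - 1))) ⊗ₜ[Kq] 1

section Splice

variable {D A : Type*} [Monoid D] [Monoid A] (L R : D →* A) {a : ℕ → D} {c : ℕ → A} {N : ℕ}

theorem prod_splice_left (h₁ : ∀ t < N, c t = L (a t)) {k : ℕ} (hk : k ≤ N) :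
    ((List.range k).map c).prod = L ((List.range k).map a).prod := by
  rw [map_list_prod, List.map_map]
  congr 1
  refine List.map_congr_left fun t ht => ?_
  exact h₁ t ((List.mem_range.1 ht).trans_le hk)

theorem prod_splice_right (h₁ : ∀ t < N, c t = L (a t)) (h₂ : c N = L (a N) * R (a 0))
    (h₃ : ∀ t > 0, c (N + t) = R (a t)) (s : ℕ) :
    ((List.range (N + (s + 1))).map c).prod =
      L ((List.range (N + 1)).map a).prod * R ((List.range (s + 1)).map a).prod := by
  induction s with
  | zero =>
    rw [List.range_succ, List.map_append, List.prod_append, prod_splice_left L h₁ le_rfl,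
      List.range_succ, List.map_append, List.prod_append, map_mul]
    simp [h₂, mul_assoc]
  | succ s ih =>
    rw [← add_assoc, List.range_succ, List.map_append, List.prod_append, ih,
      List.range_succ (n := s + 1), List.map_append, List.prod_append, map_mul]
    simp [h₃, mul_assoc]

end Splice

theorem sum_splice {k D A : Type*} [Field k] [Ring D] [Semiring A] [Algebra k D] [Algebra k A]
    (L R : D →ₐ[k] A) {a : ℕ → D} {c : ℕ → A} {N : ℕ} (x q : k)
    (h₁ : ∀ t < N, c t = L (a t)) (h₂ : c N = L (a N) * R (a 0))
    (h₃ : ∀ t > 0, c (N + t) = R (a t)) :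
    x • ∑ j ∈ Finset.Icc 1 (N + N), q ^ (j - 1) • ((List.range j).map c).prod =
      L (∑ r ∈ Finset.range N, (x * q ^ r) • ((List.range (r + 1)).map a).prod) +
      L (q ^ N • ((List.range (N + 1)).map a).prod) *
        R (∑ r ∈ Finset.range N, (x * q ^ r) • ((List.range (r + 1)).map a).prod) := by
  have hshift : ∑ j ∈ Finset.Icc 1 (N + N), q ^ (j - 1) • ((List.range j).map c).prod =
      ∑ j ∈ Finset.range (N + N), q ^ j • ((List.range (j + 1)).map c).prod := by
    rw [Finset.range_eq_Ico]
    exact (Finset.sum_Ico_add' (fun j => q ^ (j - 1) • ((List.range j).map c).prod)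
      0 (N + N) 1).symm
  rw [hshift, Finset.sum_range_add, smul_add, Finset.smul_sum, Finset.smul_sum, map_sum, map_sum,
    Finset.mul_sum]
  congr 1
  · refine Finset.sum_congr rfl fun r hr => ?_
    rw [map_smul, mul_smul, prod_splice_left (L : D →* A) h₁ (Finset.mem_range.1 hr)]
    rfl
  · refine Finset.sum_congr rfl fun r _ => ?_
    rw [map_smul, map_smul, add_assoc, prod_splice_right (L : D →* A) (R : D →* A) h₁ h₂ h₃,
      smul_mul_smul_comm, smul_smul]
    congr 1
    ring

section InvertibleIn

variable {k A : Type*} [Field k] [Semiring A] [Algebra k A]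

/-- The elements of a subalgebra that have a two-sided inverse in it, as a submonoid. -/
def Subalgebra.invertibles (S : Subalgebra k A) : Submonoid A where
  carrier := {x | x ∈ S ∧ ∃ y ∈ S, x * y = 1 ∧ y * x = 1}
  one_mem' := ⟨S.one_mem, 1, S.one_mem, one_mul 1, one_mul 1⟩
  mul_mem' := by
    rintro x x' ⟨hx, y, hy, h1, h2⟩ ⟨hx', y', hy', h1', h2'⟩
    refine ⟨S.mul_mem hx hx', y' * y, S.mul_mem hy' hy, ?_, ?_⟩
    · rw [mul_assoc, ← mul_assoc x', h1', one_mul, h1]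
    · rw [mul_assoc, ← mul_assoc y, h2, one_mul, h2']

theorem Subalgebra.mem_of_mul_smul_eq_one {S : Subalgebra k A} {x z : A} {a : k}
    (hx : x ∈ S.invertibles) (h : z * a • x = 1) : z ∈ S := by
  obtain ⟨-, y, hy, h1, -⟩ := hx
  have ha : a • z = y := by
    rw [← mul_one (a • z), ← h1, ← mul_assoc, smul_mul_assoc, ← mul_smul_comm, h, one_mul]
  by_cases h0 : a = 0
  · have : (1 : A) = 0 := by simpa [h0] using h.symm
    rw [← mul_one z, this, mul_zero]
    exact S.zero_mem
  · rw [← inv_smul_smul₀ h0 z, ha]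
    exact S.smul_mem hy _

theorem Subalgebra.list_prod_mem_invertibles {S : Subalgebra k A} {c : ℕ → A} {N : ℕ}
    (hc : ∀ t < N, c t ∈ S.invertibles) {j : ℕ} (hj : j ≤ N) :
    ((List.range j).map c).prod ∈ S.invertibles := by
  refine Submonoid.list_prod_mem _ fun x hx => ?_
  obtain ⟨t, ht, rfl⟩ := List.mem_map.1 hx
  exact hc t ((List.mem_range.1 ht).trans_le hj)

end InvertibleIn

theorem Xg_mul_Xinv (n : ℕ) (v : DnLabel) : Xg n v * Xinv n v = 1 := by
  unfold Xg Xinv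
  split_ifs with h
  · rw [← map_mul, RingQuot.mkAlgHom_rel Kq (DnRel.mul_inv ⟨v, h⟩), map_one]
  · exact one_mul 1

theorem Xinv_mul_Xg (n : ℕ) (v : DnLabel) : Xinv n v * Xg n v = 1 := by
  unfold Xg Xinv
  split_ifs with h
  · rw [← map_mul, RingQuot.mkAlgHom_rel Kq (DnRel.inv_mul ⟨v, h⟩), map_one]
  · exact one_mul 1

theorem Xg_tmul_one_mem (n : ℕ) {v : DnLabel} (hv : v.valid n) (h : ∀ j : ℤ, v ≠ .V j j) :
    Xg n v ⊗ₜ[Kq] (1 : Dtorus n) ∈ (Zalg n).invertibles := by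
  refine ⟨Algebra.subset_adjoin (Or.inl (Or.inl ⟨v, hv, h, Or.inl rfl⟩)), Xinv n v ⊗ₜ[Kq] 1,
    Algebra.subset_adjoin (Or.inl (Or.inl ⟨v, hv, h, Or.inr rfl⟩)), ?_, ?_⟩
  · rw [Algebra.TensorProduct.tmul_mul_tmul, Xg_mul_Xinv, one_mul]; rfl
  · rw [Algebra.TensorProduct.tmul_mul_tmul, Xinv_mul_Xg, one_mul]; rfl

theorem one_tmul_Xg_mem (n : ℕ) {v : DnLabel} (hv : v.valid n) (h : ∀ j : ℤ, v ≠ .V j (-j)) :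
    (1 : Dtorus n) ⊗ₜ[Kq] Xg n v ∈ (Zalg n).invertibles := by
  refine ⟨Algebra.subset_adjoin (Or.inl (Or.inr ⟨v, hv, h, Or.inl rfl⟩)), 1 ⊗ₜ[Kq] Xinv n v,
    Algebra.subset_adjoin (Or.inl (Or.inr ⟨v, hv, h, Or.inr rfl⟩)), ?_, ?_⟩
  · rw [Algebra.TensorProduct.tmul_mul_tmul, Xg_mul_Xinv, one_mul]; rfl
  · rw [Algebra.TensorProduct.tmul_mul_tmul, Xinv_mul_Xg, one_mul]; rfl

theorem Xg_tmul_Xg_mem (n : ℕ) {j : ℤ} (h₁ : 1 ≤ j) (h₂ : j ≤ n) :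
    Xg n (.V j j) ⊗ₜ[Kq] Xg n (.V j (-j)) ∈ (Zalg n).invertibles := by
  refine ⟨Algebra.subset_adjoin (Or.inr ⟨j, h₁, h₂, Or.inl rfl⟩),
    Xinv n (.V j j) ⊗ₜ[Kq] Xinv n (.V j (-j)),
    Algebra.subset_adjoin (Or.inr ⟨j, h₁, h₂, Or.inr rfl⟩), ?_, ?_⟩
  · rw [Algebra.TensorProduct.tmul_mul_tmul, Xg_mul_Xinv, Xg_mul_Xinv]; rfl
  · rw [Algebra.TensorProduct.tmul_mul_tmul, Xinv_mul_Xg, Xinv_mul_Xg]; rfl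

theorem Lam_valid (n : ℕ) {i r : ℤ} (h₁ : 1 ≤ i) (h₂ : i ≤ n) (h₃ : -i ≤ r) (h₄ : r ≤ i) :
    (Lam n i r).valid n := by
  unfold Lam th
  split_ifs <;> simp only [DnLabel.valid] <;> omega

theorem Lam_ne_V_neg (n : ℕ) {i r : ℤ} (h₂ : i ≤ n) (h₃ : -i ≤ r) (h₄ : r < i) (j : ℤ) :
    Lam n i r ≠ .V j (-j) := by
  unfold Lam th
  split_ifs <;> simp only [ne_eq, DnLabel.V.injEq, reduceCtorEq, not_false_eq_true] <;> omega

theorem Lam_ne_V_self (n : ℕ) {i r : ℤ} (h₂ : i ≤ n) (h₃ : -i < r) (h₄ : r ≤ i) (j : ℤ) :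
    Lam n i r ≠ .V j j := by
  unfold Lam th
  split_ifs <;> simp only [ne_eq, DnLabel.V.injEq, reduceCtorEq, not_false_eq_true] <;> omega

theorem Zpath_mem (n : ℕ) {i : ℤ} (h₁ : 1 ≤ i) (h₂ : i ≤ n) {t : ℕ} (ht : (t : ℤ) < 4 * i + 1) :
    Zpath n i (t + 1) ∈ (Zalg n).invertibles := by
  unfold Zpath
  push_cast
  split_ifs
  · refine Xg_tmul_one_mem n ?_ ?_ <;>
      simp only [DnLabel.valid, ne_eq, DnLabel.V.injEq] <;> omega
  · exact Xg_tmul_Xg_mem n h₁ h₂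
  · refine one_tmul_Xg_mem n ?_ ?_ <;>
      simp only [DnLabel.valid, ne_eq, DnLabel.V.injEq] <;> omega

theorem Wpath_mem (n : ℕ) {i : ℤ} (h₁ : 1 ≤ i) (h₂ : i ≤ n) {t : ℕ} (ht : (t : ℤ) < 4 * i + 1) :
    Wpath n i (t + 1) ∈ (Zalg n).invertibles := by
  unfold Wpath
  push_cast
  split_ifs
  · exact one_tmul_Xg_mem n (Lam_valid n h₁ h₂ (by omega) (by omega))
      (Lam_ne_V_neg n h₂ (by omega) (by omega))
  · have e₁ : Lam n i (-i) = .V (th n i) (th n i) := by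
      rw [Lam, if_neg (by omega), if_pos (by omega), neg_neg]
    have e₂ : Lam n i i = .V (th n i) (-(th n i)) := by
      rw [Lam, if_pos (by omega)]
    rw [e₁, e₂]
    exact Xg_tmul_Xg_mem n (by unfold th; omega) (by unfold th; omega)
  · exact Xg_tmul_one_mem n (Lam_valid n h₁ h₂ (by omega) (by omega))
      (Lam_ne_V_self n h₂ (by omega) (by omega))

theorem sum_Icc_neg_eq_sum_range {M : Type*} [AddCommMonoid M] (m : ℕ) (g : ℤ → M) :
    ∑ r ∈ Finset.Icc (-(m : ℤ)) (m - 1), g r = ∑ r ∈ Finset.range (2 * m), g (-m + r) := by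
  symm
  refine Finset.sum_bij (fun r _ => -(m : ℤ) + r) ?_ ?_ ?_ ?_
  · intro r hr
    simp only [Finset.mem_range, Finset.mem_Icc] at hr ⊢
    omega
  · intro r _ s _ h
    simpa using h
  · intro b hb
    simp only [Finset.mem_range, Finset.mem_Icc] at hb ⊢
    exact ⟨(b + m).toNat, by omega, by omega⟩
  · exact fun _ _ => rfl

theorem Vprod_eq (n : ℕ) {i r : ℤ} {k : ℕ} (h : r + i + 1 = k) :
    Vprod n i r = ((List.range k).map fun t : ℕ => Xg n (.V i (-i + t))).prod := by
  simp [Vprod, h, ← List.map_eq_flatMap, Function.comp_def]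

theorem Lprod_eq (n : ℕ) {i r : ℤ} {k : ℕ} (h : r + i + 1 = k) :
    Lprod n i r = ((List.range k).map fun t : ℕ => Xg n (Lam n i (-i + t))).prod := by
  simp [Lprod, h, ← List.map_eq_flatMap, Function.comp_def]

theorem sum_ww (n m : ℕ) :
    ∑ r ∈ Finset.Icc (-(m : ℤ)) (m - 1), ww n m r =
      ∑ r ∈ Finset.range (2 * m),
        (ii * qq ^ r) • ((List.range (r + 1)).map fun k : ℕ => Xg n (.V m (-m + k))).prod := by
  rw [sum_Icc_neg_eq_sum_range]
  refine Finset.sum_congr rfl fun r _ => ?_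
  rw [ww, Vprod_eq n (k := r + 1) (by push_cast; ring), add_neg_cancel_left, zpow_natCast]

theorem sum_mm (n m : ℕ) :
    ∑ r ∈ Finset.Icc (-(m : ℤ)) (m - 1), mm n m r =
      ∑ r ∈ Finset.range (2 * m),
        (ii * qq ^ r) • ((List.range (r + 1)).map fun k : ℕ => Xg n (Lam n m (-m + k))).prod := by
  rw [sum_Icc_neg_eq_sum_range]
  refine Finset.sum_congr rfl fun r _ => ?_
  rw [mm, Lprod_eq n (k := r + 1) (by push_cast; ring), add_neg_cancel_left, zpow_natCast]

section Paths

open Algebra.TensorProduct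

variable (n m : ℕ)

theorem Zpath_left (t : ℕ) (ht : t < 2 * m) :
    Zpath n m (t + 1) = (includeLeft : Dtorus n →ₐ[Kq] AA n) (Xg n (.V m (-m + t))) := by
  rw [Zpath, if_pos (by omega), includeLeft_apply]
  congr 3
  omega

theorem Zpath_mid :
    Zpath n m (2 * m + 1) =
      (includeLeft : Dtorus n →ₐ[Kq] AA n) (Xg n (.V m (-m + (2 * m : ℕ)))) *
        (includeRight : Dtorus n →ₐ[Kq] AA n) (Xg n (.V m (-m + (0 : ℕ)))) := by
  rw [Zpath, if_neg (by omega), if_pos (by omega), includeLeft_apply, includeRight_apply,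
    tmul_mul_tmul, one_mul, mul_one, show -(m : ℤ) + (2 * m : ℕ) = m by omega,
    Nat.cast_zero, add_zero]

theorem Zpath_right (t : ℕ) (ht : t > 0) :
    Zpath n m (2 * m + t + 1) =
      (includeRight : Dtorus n →ₐ[Kq] AA n) (Xg n (.V m (-m + t))) := by
  rw [Zpath, if_neg (by omega), if_neg (by omega), includeRight_apply]
  congr 3
  omega

theorem Wpath_left (t : ℕ) (ht : t < 2 * m) :
    Wpath n m (t + 1) = (includeRight : Dtorus n →ₐ[Kq] AA n) (Xg n (Lam n m (-m + t))) := by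
  rw [Wpath, if_pos (by omega), includeRight_apply]
  congr 3
  omega

theorem Wpath_mid :
    Wpath n m (2 * m + 1) =
      (includeRight : Dtorus n →ₐ[Kq] AA n) (Xg n (Lam n m (-m + (2 * m : ℕ)))) *
        (includeLeft : Dtorus n →ₐ[Kq] AA n) (Xg n (Lam n m (-m + (0 : ℕ)))) := by
  rw [Wpath, if_neg (by omega), if_pos (by omega), includeLeft_apply, includeRight_apply,
    tmul_mul_tmul, one_mul, mul_one, show -(m : ℤ) + (2 * m : ℕ) = m by omega,
    Nat.cast_zero, add_zero]

theorem Wpath_right (t : ℕ) (ht : t > 0) :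
    Wpath n m (2 * m + t + 1) =
      (includeLeft : Dtorus n →ₐ[Kq] AA n) (Xg n (Lam n m (-m + t))) := by
  rw [Wpath, if_neg (by omega), if_neg (by omega), includeLeft_apply]
  congr 3
  omega

theorem sum_Zpath :
    ii • ∑ k ∈ Finset.Icc 1 (4 * (m : ℤ)).toNat,
        (qq ^ (k - 1)) • ((List.range k).map fun t => Zpath n m (t + 1)).prod =
      (∑ r ∈ Finset.Icc (-(m : ℤ)) (m - 1), ww n m r) ⊗ₜ[Kq] 1 +
        ((qq ^ (2 * (m : ℤ))) • Vprod n m m) ⊗ₜ[Kq]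
          ∑ r ∈ Finset.Icc (-(m : ℤ)) (m - 1), ww n m r := by
  rw [show (4 * (m : ℤ)).toNat = 2 * m + 2 * m by omega,
    sum_splice includeLeft includeRight ii qq (Zpath_left n m) (Zpath_mid n m) (Zpath_right n m),
    ← sum_ww, includeLeft_apply, includeLeft_apply, includeRight_apply, tmul_mul_tmul, one_mul,
    mul_one, Vprod_eq n (k := 2 * m + 1) (by push_cast; ring),
    show 2 * (m : ℤ) = (2 * m : ℕ) by push_cast; rfl, zpow_natCast]

theorem sum_Wpath :
    ii • ∑ k ∈ Finset.Icc 1 (4 * (m : ℤ)).toNat,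
        (qq ^ (k - 1)) • ((List.range k).map fun t => Wpath n m (t + 1)).prod =
      (∑ r ∈ Finset.Icc (-(m : ℤ)) (m - 1), mm n m r) ⊗ₜ[Kq]
          ((qq ^ (2 * (m : ℤ))) • Lprod n m m) +
        1 ⊗ₜ[Kq] ∑ r ∈ Finset.Icc (-(m : ℤ)) (m - 1), mm n m r := by
  rw [show (4 * (m : ℤ)).toNat = 2 * m + 2 * m by omega,
    sum_splice includeRight includeLeft ii qq (Wpath_left n m) (Wpath_mid n m) (Wpath_right n m),
    ← sum_mm, includeLeft_apply, includeRight_apply, includeRight_apply, tmul_mul_tmul, one_mul,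
    mul_one, Lprod_eq n (k := 2 * m + 1) (by push_cast; ring),
    show 2 * (m : ℤ) = (2 * m : ℕ) by push_cast; rfl, zpow_natCast, add_comm]

theorem qq_ne_zero : qq ≠ 0 := RatFunc.X_ne_zero

theorem prod_Zpath :
    (qq ^ (4 * (m : ℤ))) •
        ((List.range (4 * (m : ℤ) + 1).toNat).map fun t => Zpath n m (t + 1)).prod =
      ((qq ^ (2 * (m : ℤ))) • Vprod n m m) ⊗ₜ[Kq] ((qq ^ (2 * (m : ℤ))) • Vprod n m m) := by
  have h := prod_splice_right ((includeLeft : Dtorus n →ₐ[Kq] AA n) : Dtorus n →* AA n)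
    ((includeRight : Dtorus n →ₐ[Kq] AA n) : Dtorus n →* AA n)
    (Zpath_left n m) (Zpath_mid n m) (Zpath_right n m) (2 * m)
  rw [show (4 * (m : ℤ) + 1).toNat = 2 * m + (2 * m + 1) by omega, h, TensorProduct.smul_tmul_smul,
    ← zpow_add₀ qq_ne_zero, show 2 * (m : ℤ) + 2 * m = 4 * m by ring,
    Vprod_eq n (k := 2 * m + 1) (by push_cast; ring)]
  congr 1
  simp only [MonoidHom.coe_coe, includeLeft_apply, includeRight_apply, tmul_mul_tmul, one_mul,
    mul_one]

theorem prod_Wpath :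
    (qq ^ (4 * (m : ℤ))) •
        ((List.range (4 * (m : ℤ) + 1).toNat).map fun t => Wpath n m (t + 1)).prod =
      ((qq ^ (2 * (m : ℤ))) • Lprod n m m) ⊗ₜ[Kq] ((qq ^ (2 * (m : ℤ))) • Lprod n m m) := by
  have h := prod_splice_right ((includeRight : Dtorus n →ₐ[Kq] AA n) : Dtorus n →* AA n)
    ((includeLeft : Dtorus n →ₐ[Kq] AA n) : Dtorus n →* AA n)
    (Wpath_left n m) (Wpath_mid n m) (Wpath_right n m) (2 * m)
  rw [show (4 * (m : ℤ) + 1).toNat = 2 * m + (2 * m + 1) by omega, h, TensorProduct.smul_tmul_smul,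
    ← zpow_add₀ qq_ne_zero, show 2 * (m : ℤ) + 2 * m = 4 * m by ring,
    Lprod_eq n (k := 2 * m + 1) (by push_cast; ring)]
  congr 1
  simp only [MonoidHom.coe_coe, includeLeft_apply, includeRight_apply, tmul_mul_tmul, one_mul,
    mul_one]

end Paths

theorem thIdx_thIdx (n : ℕ) (i : Idx n) : thIdx n (thIdx n i) = i :=
  Subtype.ext (by simp only [thIdx, th]; ring)

theorem DDalg_hom_mem {n : ℕ} {A : Type*} [Semiring A] [Algebra Kq A] (g : DDalg n →ₐ[Kq] A)
    (S : Subalgebra Kq A) (h : ∀ x, g (DDgen n x) ∈ S) (x : DDalg n) : g x ∈ S := by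
  obtain ⟨y, rfl⟩ := RingQuot.mkAlgHom_surjective Kq (DDRel n) x
  induction y using FreeAlgebra.induction with
  | grade0 r => simpa only [AlgHom.commutes] using S.algebraMap_mem r
  | grade1 x => exact h x
  | mul a b ha hb => simpa only [map_mul] using S.mul_mem ha hb
  | add a b ha hb => simpa only [map_add] using S.add_mem ha hb


/-- Explicit cluster formulas for `(ι⊗ι)∘Δ` on the generators of `𝔇ₙ`,
in terms of the `VV_i`- and `ΛΛ_i`-paths; consequently `(ι⊗ι)∘Δ` maps `𝔇ₙ` into the
subalgebra `𝒵ₙ ⊆ 𝒟ₙ ⊗ 𝒟ₙ`. -/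
theorem statement15 (n : ℕ) (hn : 1 ≤ n)
    (f : DDalg n →ₐ[Kq] Dtorus n) (hf : iotaSpec n f)
    (Δ : DDalg n →ₐ[Kq] (DDalg n ⊗[Kq] DDalg n)) (hΔ : deltaSpec n Δ) :
    (∀ i : Idx n,
      (Algebra.TensorProduct.map f f) (Δ (DDgen n (.E i)))
        = ii • ∑ k ∈ Finset.Icc 1 (4 * i.1).toNat,
            (qq ^ (k - 1)) • ((List.range k).map fun t => Zpath n i.1 (t + 1)).prod ∧
      (Algebra.TensorProduct.map f f) (Δ (DDgen n (.K i)))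
        = (qq ^ (4 * i.1)) •
            ((List.range (4 * i.1 + 1).toNat).map fun t => Zpath n i.1 (t + 1)).prod ∧
      (Algebra.TensorProduct.map f f) (Δ (DDgen n (.F (thIdx n i))))
        = ii • ∑ k ∈ Finset.Icc 1 (4 * i.1).toNat,
            (qq ^ (k - 1)) • ((List.range k).map fun t => Wpath n i.1 (t + 1)).prod ∧
      (Algebra.TensorProduct.map f f) (Δ (DDgen n (.K' (thIdx n i))))
        = (qq ^ (4 * i.1)) •
            ((List.range (4 * i.1 + 1).toNat).map fun t => Wpath n i.1 (t + 1)).prod) ∧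
    (∀ x : DDalg n, (Algebra.TensorProduct.map f f) (Δ x) ∈ Zalg n) := by
  have formulas : ∀ i : Idx n,
      (Algebra.TensorProduct.map f f) (Δ (DDgen n (.E i)))
        = ii • ∑ k ∈ Finset.Icc 1 (4 * i.1).toNat,
            (qq ^ (k - 1)) • ((List.range k).map fun t => Zpath n i.1 (t + 1)).prod ∧
      (Algebra.TensorProduct.map f f) (Δ (DDgen n (.K i)))
        = (qq ^ (4 * i.1)) •
            ((List.range (4 * i.1 + 1).toNat).map fun t => Zpath n i.1 (t + 1)).prod ∧
      (Algebra.TensorProduct.map f f) (Δ (DDgen n (.F (thIdx n i))))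
        = ii • ∑ k ∈ Finset.Icc 1 (4 * i.1).toNat,
            (qq ^ (k - 1)) • ((List.range k).map fun t => Wpath n i.1 (t + 1)).prod ∧
      (Algebra.TensorProduct.map f f) (Δ (DDgen n (.K' (thIdx n i))))
        = (qq ^ (4 * i.1)) •
            ((List.range (4 * i.1 + 1).toNat).map fun t => Wpath n i.1 (t + 1)).prod := by
    intro i
    obtain ⟨hE, hK, hF, hK', -⟩ := hf i
    obtain ⟨dE, -, dK, -⟩ := hΔ i
    obtain ⟨-, dF, -, dK', -⟩ := hΔ (thIdx n i)
    rw [dE, dK, dF, dK']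
    simp only [map_add, Algebra.TensorProduct.map_tmul, map_one, hE, hK, hF, hK']
    obtain ⟨m, hm⟩ := Int.eq_ofNat_of_zero_le (show 0 ≤ i.1 by have := i.2.1; omega)
    rw [hm]
    exact ⟨(sum_Zpath n m).symm, (prod_Zpath n m).symm, (sum_Wpath n m).symm,
      (prod_Wpath n m).symm⟩
  refine ⟨formulas, ?_⟩
  have hZ (i : Idx n) {k : ℕ} (hk : k ≤ (4 * i.1 + 1).toNat) :
      ((List.range k).map fun t => Zpath n i.1 (t + 1)).prod ∈ (Zalg n).invertibles :=
    Subalgebra.list_prod_mem_invertibles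
      (fun t ht => Zpath_mem n i.2.1 i.2.2 (by omega)) hk
  have hW (i : Idx n) {k : ℕ} (hk : k ≤ (4 * i.1 + 1).toNat) :
      ((List.range k).map fun t => Wpath n i.1 (t + 1)).prod ∈ (Zalg n).invertibles :=
    Subalgebra.list_prod_mem_invertibles
      (fun t ht => Wpath_mem n i.2.1 i.2.2 (by omega)) hk
  refine DDalg_hom_mem ((Algebra.TensorProduct.map f f).comp Δ) (Zalg n) fun x => ?_
  rw [AlgHom.comp_apply]
  rcases x with i | i | i | i | i | i
  · rw [(formulas i).1]
    refine (Zalg n).smul_mem ((Zalg n).sum_mem fun k hk => (Zalg n).smul_mem (hZ i ?_).1 _) _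
    have := (Finset.mem_Icc.1 hk).2
    omega
  · rw [← thIdx_thIdx n i, (formulas (thIdx n i)).2.2.1]
    refine (Zalg n).smul_mem ((Zalg n).sum_mem fun k hk => (Zalg n).smul_mem (hW _ ?_).1 _) _
    have := (Finset.mem_Icc.1 hk).2
    omega
  · rw [(formulas i).2.1]
    exact (Zalg n).smul_mem (hZ i le_rfl).1 _
  · rw [← thIdx_thIdx n i, (formulas (thIdx n i)).2.2.2]
    exact (Zalg n).smul_mem (hW _ le_rfl).1 _
  · refine Subalgebra.mem_of_mul_smul_eq_one (hZ i le_rfl) (a := qq ^ (4 * i.1)) ?_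
    rw [← (formulas i).2.1, (hΔ i).2.2.1, (hΔ i).2.2.2.2.1, Algebra.TensorProduct.map_tmul,
      Algebra.TensorProduct.map_tmul, Algebra.TensorProduct.tmul_mul_tmul, (hf i).2.2.2.2.1]
    rfl
  · refine Subalgebra.mem_of_mul_smul_eq_one (hW (thIdx n i) le_rfl)
      (a := qq ^ (4 * (thIdx n i).1)) ?_
    rw [← (formulas (thIdx n i)).2.2.2, thIdx_thIdx, (hΔ i).2.2.2.1, (hΔ i).2.2.2.2.2,
      Algebra.TensorProduct.map_tmul, Algebra.TensorProduct.map_tmul,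
      Algebra.TensorProduct.tmul_mul_tmul, (hf i).2.2.2.2.2.2.1]
    rfl


end
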